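/- arXiv:2407.03710 — 4 statements merged into one kernel-verified Lean document; each statement's English description precedes it below -/
import Mathlib

section
/- For every d' ∈ ℤ with |d'| ≤ 2N, the row sum of the kernel coefficients vanishes: ∑_{d=−2N}^{2N} K_M(d,d') = 0. -/
open Finset Real

noncomputable def Sig (N : ℕ) (M : ℤ → ℝ) (d : ℤ) : ℝ :=
  ∑ d₁ ∈ Finset.Icc (-(N:ℤ)) N, ∑ d₂ ∈ Finset.Icc (-(N:ℤ)) N,
    if d₁ + d₂ = d ∧ d₁ ≠ 0 ∧ d₂ ≠ 0 then M d₁ * M d₂ else 0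

/-- The kernel coefficients `K_M(d,d')`. -/
noncomputable def Kcoef (N : ℕ) (M : ℤ → ℝ) (d d' : ℤ) : ℝ :=
  if d = 0 ∧ d' = 0 then 3 * ∑ j ∈ Finset.Icc (1:ℤ) N, M j ^ 2
  else if 1 ≤ |d| ∧ |d| ≤ (N:ℤ) ∧ d' = 0 then -(M d ^ 2) - (1/2) * Sig N M d
  else if 1 ≤ |d'| ∧ |d'| ≤ (N:ℤ) ∧ d = 0 then -(M d' ^ 2) - (1/2) * Sig N M d'
  else if (N:ℤ) + 1 ≤ |d| ∧ |d| ≤ 2*(N:ℤ) ∧ d' = 0 then -(1/2) * Sig N M d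
  else if (N:ℤ) + 1 ≤ |d'| ∧ |d'| ≤ 2*(N:ℤ) ∧ d = 0 then -(1/2) * Sig N M d'
  else if (d' = d ∨ d' = -d) ∧ 1 ≤ |d| ∧ |d| ≤ 2*(N:ℤ) then
    if 2*|d| ≤ (N:ℤ) then -(1/4) * Sig N M d - M d * M (2*d)
    else -(1/4) * Sig N M d
  else if 1 ≤ |d| ∧ |d| ≤ (N:ℤ) ∧ (N:ℤ) < |d'| ∧ |d'| ≤ 2*(N:ℤ) then
    if |d' - d| ≤ (N:ℤ) then (1/2) * (M d * M (d' - d))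
    else if |d' + d| ≤ (N:ℤ) then -(1/2) * (M d * M (d' + d))
    else 0
  else if 1 ≤ |d'| ∧ |d'| ≤ (N:ℤ) ∧ (N:ℤ) < |d| ∧ |d| ≤ 2*(N:ℤ) then
    if |d - d'| ≤ (N:ℤ) then (1/2) * (M d' * M (d - d'))
    else if |d + d'| ≤ (N:ℤ) then -(1/2) * (M d' * M (d + d'))
    else 0
  else if 1 ≤ |d| ∧ |d| ≤ (N:ℤ) ∧ 1 ≤ |d'| ∧ |d'| ≤ (N:ℤ) then
    if |d - d'| ≤ (N:ℤ) ∧ |d + d'| ≤ (N:ℤ) then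
      (1/2) * (M d' * M (d - d') + M d * M (d' - d)
        - M d' * M (d + d') - M d * M (d + d'))
    else if |d - d'| ≤ (N:ℤ) ∧ (N:ℤ) < |d + d'| then
      (1/2) * (M d' * M (d - d') + M d * M (d' - d))
    else if |d + d'| ≤ (N:ℤ) ∧ (N:ℤ) < |d - d'| then
      -(1/2) * (M d' * M (d + d') + M d * M (d + d'))
    else 0
  else 0

/-- The controlled kernel `K̂_M(k,k')`. -/
noncomputable def Khat (N : ℕ) (M : ℤ → ℝ) (k k' : ℝ) : ℝ :=
  ∑ d ∈ Finset.Icc (-(2*(N:ℤ))) (2*(N:ℤ)), ∑ d' ∈ Finset.Icc (-(2*(N:ℤ))) (2*(N:ℤ)),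
    Kcoef N M d d' * Real.cos (2*π*d*k) * Real.cos (2*π*d'*k')

lemma aux_Sig (N : ℕ) (M : ℤ → ℝ)
    (hM2 : ∀ d : ℤ, (2*|d| ≤ (N:ℤ) ∨ (N:ℤ) < |d|) → M d = 0) (e : ℤ) :
    Sig N M e = ∑ d ∈ Finset.Icc (-(N:ℤ)) N, M d * M (e - d) := by
  have h0 : M 0 = 0 := hM2 0 (Or.inl (by simp))
  unfold Sig
  refine Finset.sum_congr rfl fun x hx => ?_
  by_cases hx0 : x = 0
  · subst hx0; simp [h0]
  by_cases hm : e - x ∈ Finset.Icc (-(N:ℤ)) N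
  · rw [Finset.sum_eq_single_of_mem (e - x) hm]
    · by_cases hz : e - x = 0
      · simp [hz, h0]
      · rw [if_pos ⟨by ring, hx0, hz⟩]
    · intro b _ hb
      rw [if_neg]
      rintro ⟨h, _⟩
      exact hb (by omega)
  · have : M (e - x) = 0 := hM2 _ (Or.inr (by
      rw [Finset.mem_Icc] at hm
      rw [lt_abs]; omega))
    rw [this, mul_zero]
    refine Finset.sum_eq_zero fun b hb => ?_
    rw [if_neg]
    rintro ⟨h, _⟩
    apply hm
    rwa [show e - x = b by omega]

lemma aux_neg (A : ℤ) (f : ℤ → ℝ) :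
    ∑ d ∈ Finset.Icc (-A) A, f (-d) = ∑ d ∈ Finset.Icc (-A) A, f d := by
  refine Finset.sum_nbij' (fun d => -d) (fun d => -d) ?_ ?_ ?_ ?_ ?_ <;>
    intro a <;> simp only [Finset.mem_Icc] <;> intros <;> first | omega | simp

lemma aux_big (N : ℕ) (f : ℤ → ℝ) (hf : ∀ d : ℤ, (N:ℤ) < |d| → f d = 0) (a b : ℤ)
    (ha : a ≤ -(N:ℤ)) (hb : (N:ℤ) ≤ b) :
    ∑ d ∈ Finset.Icc a b, f d = ∑ d ∈ Finset.Icc (-(N:ℤ)) N, f d := by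
  symm
  apply Finset.sum_subset (Finset.Icc_subset_Icc ha hb)
  intro x _ hx
  apply hf
  rw [Finset.mem_Icc] at hx
  rw [lt_abs]; omega

lemma aux_shift (a b e : ℤ) (f : ℤ → ℝ) :
    ∑ d ∈ Finset.Icc a b, f (d - e) = ∑ d ∈ Finset.Icc (a - e) (b - e), f d := by
  refine Finset.sum_nbij' (fun d => d - e) (fun d => d + e) ?_ ?_ ?_ ?_ ?_ <;>
    intro a <;> simp only [Finset.mem_Icc] <;> intros <;> first | omega | simp

lemma aux_zero (A : ℤ) (M : ℤ → ℝ) (hM1 : ∀ d : ℤ, M d + M (-d) = 0) :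
    ∑ d ∈ Finset.Icc (-A) A, M d = 0 := by
  have h := aux_neg A M
  have h2 : ∑ d ∈ Finset.Icc (-A) A, M (-d) = - ∑ d ∈ Finset.Icc (-A) A, M d := by
    rw [← Finset.sum_neg_distrib]
    exact Finset.sum_congr rfl fun x _ => by linarith [hM1 x]
  linarith

lemma aux_shift_zero (N : ℕ) (M : ℤ → ℝ) (hM1 : ∀ d : ℤ, M d + M (-d) = 0)
    (hM2 : ∀ d : ℤ, (2*|d| ≤ (N:ℤ) ∨ (N:ℤ) < |d|) → M d = 0) (e : ℤ) (he : |e| ≤ N) :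
    ∑ d ∈ Finset.Icc (-(2*(N:ℤ))) (2*(N:ℤ)), M (d - e) = 0 := by
  rw [abs_le] at he
  rw [aux_shift, aux_big N M (fun d h => hM2 d (Or.inr h)) _ _ (by omega) (by omega)]
  exact aux_zero _ M hM1

lemma aux_Sig_neg (N : ℕ) (M : ℤ → ℝ) (hM1 : ∀ d : ℤ, M d + M (-d) = 0)
    (hM2 : ∀ d : ℤ, (2*|d| ≤ (N:ℤ) ∨ (N:ℤ) < |d|) → M d = 0) (e : ℤ) :
    Sig N M (-e) = Sig N M e := by
  rw [aux_Sig N M hM2, aux_Sig N M hM2, ← aux_neg]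
  refine Finset.sum_congr rfl fun x _ => ?_
  have h1 := hM1 x
  have h2 := hM1 (e - x)
  rw [show -e - -x = -(e - x) by ring, show M (-x) = - M x by linarith,
    show M (-(e-x)) = - M (e-x) by linarith]
  ring

lemma aux_sq (N : ℕ) (M : ℤ → ℝ) (hM1 : ∀ d : ℤ, M d + M (-d) = 0) (n : ℕ) :
    ∑ d ∈ Finset.Icc (-(n:ℤ)) n, M d ^ 2 = 2 * ∑ j ∈ Finset.Icc (1:ℤ) n, M j ^ 2 := by
  have h0 : M 0 = 0 := by have := hM1 0; simp at this; exact this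
  have hu : Finset.Icc (-(n:ℤ)) n =
      insert 0 (Finset.Icc (1:ℤ) n ∪ (Finset.Icc (1:ℤ) n).image (fun d => -d)) := by
    ext x
    simp only [Finset.mem_Icc, Finset.mem_insert, Finset.mem_union, Finset.mem_image]
    constructor
    · intro h
      rcases lt_trichotomy x 0 with hx | hx | hx
      · exact Or.inr (Or.inr ⟨-x, by omega, by omega⟩)
      · exact Or.inl hx
      · exact Or.inr (Or.inl (by omega))
    · rintro (h | h | ⟨y, h, rfl⟩) <;> omega
  rw [hu, Finset.sum_insert, Finset.sum_union, Finset.sum_image]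
  · have : ∀ x ∈ Finset.Icc (1:ℤ) n, M (-x) ^ 2 = M x ^ 2 := fun x _ => by
      rw [show M (-x) = - M x by linarith [hM1 x]]; ring
    rw [Finset.sum_congr rfl this, h0]; ring
  · intro a _ b _ h; simpa using h
  · rw [Finset.disjoint_left]
    intro a ha hb
    simp only [Finset.mem_Icc, Finset.mem_image] at ha hb
    obtain ⟨y, h, rfl⟩ := hb
    omega
  · simp only [Finset.mem_Icc, Finset.mem_union, Finset.mem_image]
    rintro (h | ⟨y, h, h'⟩) <;> omega

lemma aux_K0 (N : ℕ) (M : ℤ → ℝ) (h0 : M 0 = 0)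
    (hM2 : ∀ d : ℤ, (2*|d| ≤ (N:ℤ) ∨ (N:ℤ) < |d|) → M d = 0)
    (d : ℤ) (hd : |d| ≤ 2*(N:ℤ)) :
    Kcoef N M d 0 = -(M d ^ 2) - (1/2) * Sig N M d +
      if d = 0 then 3 * ∑ j ∈ Finset.Icc (1:ℤ) N, M j ^ 2 + (1/2) * Sig N M 0 else 0 := by
  unfold Kcoef
  by_cases h : d = 0
  · subst h; simp [h0]
  have h1 : 1 ≤ |d| := Int.one_le_abs h
  by_cases h2 : |d| ≤ N
  · simp [h, h1, h2]
  · have h3 : (N:ℤ) + 1 ≤ |d| := by omega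
    have := hM2 d (Or.inr (by omega))
    simp [h, h2, h3, hd, this]

lemma aux_Ke (N : ℕ) (M : ℤ → ℝ) (hM1 : ∀ d : ℤ, M d + M (-d) = 0)
    (hM2 : ∀ d : ℤ, (2*|d| ≤ (N:ℤ) ∨ (N:ℤ) < |d|) → M d = 0)
    (e : ℤ) (he0 : e ≠ 0) (he : |e| ≤ 2*(N:ℤ)) (d : ℤ) (hd : |d| ≤ 2*(N:ℤ)) :
    Kcoef N M d e = (1/2) * (M e * M (d - e) + M d * M (e - d)
        - M e * M (d + e) - M d * M (d + e))
      + (if d = 0 then -(1/2) * Sig N M e else 0)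
      + (if d = e then -(1/4) * Sig N M e else 0)
      + (if d = -e then -(1/4) * Sig N M e else 0) := by
  have h0 : M 0 = 0 := hM2 0 (Or.inl (by simp))
  have h1 : 1 ≤ |e| := Int.one_le_abs he0
  have hee : e ≠ -e := by omega
  have hee' : -e ≠ e := by omega
  have hprod : M e * M (2*e) = 0 := by
    by_cases h : 2*|e| ≤ N
    · rw [hM2 e (Or.inl h), zero_mul]
    · rw [hM2 (2*e) (Or.inr (by rw [abs_mul]; simpa using h)), mul_zero]
  have hneg : M (-e) = - M e := by linarith [hM1 e]
  have hneg2 : M (-(2*e)) = - M (2*e) := by linarith [hM1 (2*e)]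
  have hS := aux_Sig_neg N M hM1 hM2 e
  by_cases hd0 : d = 0
  · subst hd0
    unfold Kcoef
    by_cases h2 : |e| ≤ N
    · simp [he0, h1, h2, h0, hneg, he0.symm, (neg_ne_zero.mpr he0).symm]; ring
    · have h3 : (N:ℤ) + 1 ≤ |e| := by omega
      have := hM2 e (Or.inr (by omega))
      simp [he0, h2, h3, he, this, h0, he0.symm, (neg_ne_zero.mpr he0).symm]
  by_cases hde : d = e
  · subst hde
    unfold Kcoef
    rw [if_neg (by tauto), if_neg (by tauto), if_neg (by tauto), if_neg (by tauto),
      if_neg (by tauto), if_pos ⟨Or.inl rfl, h1, hd⟩, if_neg hd0, if_pos rfl, if_neg hee,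
      sub_self, h0, ← two_mul d, hprod]
    split_ifs <;> linarith
  by_cases hdn : d = -e
  · subst hdn
    unfold Kcoef
    rw [if_neg (by tauto), if_neg (by tauto), if_neg (by tauto), if_neg (by tauto),
      if_neg (by tauto), if_pos ⟨Or.inr (by ring), by rwa [abs_neg], hd⟩, if_neg hd0,
      if_neg hee', if_pos rfl, hS, show -e - e = -(2*e) by ring, show e - -e = 2*e by ring,
      show 2 * -e = -(2*e) by ring, neg_add_cancel, h0, hneg, hneg2]
    split_ifs <;> linarith
  have hd1 : 1 ≤ |d| := Int.one_le_abs hd0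
  have hz : ∀ x : ℤ, ¬ |x| ≤ N → M x = 0 := fun x hx => hM2 x (Or.inr (by omega))
  have hnn : ¬ (e = d ∨ e = -d) := by omega
  have hsw : |e - d| = |d - e| := abs_sub_comm e d
  have hsw2 : |e + d| = |d + e| := by rw [add_comm]
  have hsw3 : M (e + d) = M (d + e) := by rw [add_comm]
  simp only [hd0, hde, hdn, if_false, add_zero]
  unfold Kcoef
  rw [if_neg (by tauto), if_neg (by tauto), if_neg (by tauto), if_neg (by tauto),
    if_neg (by tauto), if_neg (by tauto)]
  by_cases hA : |d| ≤ N <;> by_cases hB : |e| ≤ N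
  · rw [if_neg (by omega), if_neg (by omega), if_pos (by omega)]
    by_cases hC : |d - e| ≤ N <;> by_cases hD : |d + e| ≤ N
    · rw [if_pos ⟨hC, hD⟩]
    · rw [if_neg (by omega), if_pos (by omega), hz _ hD]; ring
    · have := hz (e - d) (by rwa [hsw])
      rw [if_neg (by omega), if_neg (by omega), if_pos (by omega), hz _ hC, this]; ring
    · have := hz (e - d) (by rwa [hsw])
      rw [if_neg (by omega), if_neg (by omega), if_neg (by omega), hz _ hC, hz _ hD, this]; ring
  · rw [if_pos (by omega), hz _ hB, hsw, hsw2, hsw3]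
    by_cases hC : |d - e| ≤ N
    · have hD : ¬ |d + e| ≤ N := by
        rw [abs_le] at *; omega
      rw [if_pos hC, hz _ hD]; ring
    · have := hz (e - d) (by rwa [hsw])
      rw [if_neg hC, this]
      by_cases hD : |d + e| ≤ N
      · rw [if_pos hD]; ring
      · rw [if_neg hD, hz _ hD]; ring
  · rw [if_neg (by omega), if_pos (by omega), hz _ hA]
    by_cases hC : |d - e| ≤ N
    · have hD : ¬ |d + e| ≤ N := by
        rw [abs_le] at *; omega
      rw [if_pos hC, hz _ hD]; ring
    · rw [if_neg hC, hz _ hC]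
      by_cases hD : |d + e| ≤ N
      · rw [if_pos hD]; ring
      · rw [if_neg hD, hz _ hD]; ring
  · rw [if_neg (by omega), if_neg (by omega), if_neg (by omega), hz _ hA, hz _ hB]; ring

/-- **Row sums of the kernel coefficients vanish:** for every `d'` with `|d'| ≤ 2N`,
`∑_{d=−2N}^{2N} K_M(d,d') = 0`. -/
theorem rowSum_Kcoef_eq_zero (N : ℕ) (hN : 1 ≤ N) (M : ℤ → ℝ)
    (hM1 : ∀ d : ℤ, M d + M (-d) = 0)
    (hM2 : ∀ d : ℤ, (2*|d| ≤ (N:ℤ) ∨ (N:ℤ) < |d|) → M d = 0)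
    (d' : ℤ) (hd' : |d'| ≤ 2*(N:ℤ)) :
    ∑ d ∈ Finset.Icc (-(2*(N:ℤ))) (2*(N:ℤ)), Kcoef N M d d' = 0 := by
  have h0 : M 0 = 0 := hM2 0 (Or.inl (by simp))
  have hzN : ∀ d : ℤ, (N:ℤ) < |d| → M d = 0 := fun d h => hM2 d (Or.inr h)
  by_cases he : d' = 0
  · subst he
    rw [Finset.sum_congr rfl fun d hd => aux_K0 N M h0 hM2 d (by
      rw [Finset.mem_Icc] at hd; rw [abs_le]; exact hd)]
    have hS0 : Sig N M 0 = - (2 * ∑ j ∈ Finset.Icc (1:ℤ) N, M j ^ 2) := by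
      rw [aux_Sig N M hM2, ← aux_sq N M hM1 N, ← Finset.sum_neg_distrib]
      refine Finset.sum_congr rfl fun x _ => ?_
      rw [zero_sub, show M (-x) = - M x by linarith [hM1 x]]; ring
    have hSS : ∑ d ∈ Finset.Icc (-(2*(N:ℤ))) (2*(N:ℤ)), Sig N M d = 0 := by
      simp_rw [aux_Sig N M hM2]
      rw [Finset.sum_comm]
      refine Finset.sum_eq_zero fun x hx => ?_
      rw [← Finset.mul_sum, aux_shift_zero N M hM1 hM2 x (by
        rw [Finset.mem_Icc] at hx; rw [abs_le]; exact hx), mul_zero]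
    have hsq := aux_big N (fun d => M d ^ 2) (fun d h => by simp [hzN d h])
      (-(2*(N:ℤ))) (2*(N:ℤ)) (by omega) (by omega)
    have hm : (0:ℤ) ∈ Finset.Icc (-(2*(N:ℤ))) (2*(N:ℤ)) := by
      rw [Finset.mem_Icc]; omega
    rw [Finset.sum_add_distrib, Finset.sum_sub_distrib, Finset.sum_neg_distrib,
      ← Finset.mul_sum, hSS, Finset.sum_ite_eq', if_pos hm, hS0, hsq, aux_sq N M hM1 N]
    ring
  · rw [Finset.sum_congr rfl fun d hd => aux_Ke N M hM1 hM2 d' he hd' d (by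
      rw [Finset.mem_Icc] at hd; rw [abs_le]; exact hd)]
    rw [abs_le] at hd'
    have e1 : M d' * ∑ d ∈ Finset.Icc (-(2*(N:ℤ))) (2*(N:ℤ)), M (d - d') = 0 := by
      by_cases h : |d'| ≤ N
      · rw [aux_shift_zero N M hM1 hM2 d' h, mul_zero]
      · rw [hzN d' (by omega), zero_mul]
    have e2 : M d' * ∑ d ∈ Finset.Icc (-(2*(N:ℤ))) (2*(N:ℤ)), M (d + d') = 0 := by
      by_cases h : |d'| ≤ N
      · have := aux_shift_zero N M hM1 hM2 (-d') (by rwa [abs_neg])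
        simp only [sub_neg_eq_add] at this
        rw [this, mul_zero]
      · rw [hzN d' (by omega), zero_mul]
    have e3 : ∑ d ∈ Finset.Icc (-(2*(N:ℤ))) (2*(N:ℤ)), M d * M (d' - d) = Sig N M d' := by
      rw [aux_Sig N M hM2]
      exact aux_big N (fun d => M d * M (d' - d)) (fun d h => by simp [hzN d h]) _ _
        (by omega) (by omega)
    have e4 : ∑ d ∈ Finset.Icc (-(2*(N:ℤ))) (2*(N:ℤ)), M d * M (d + d') = - Sig N M d' := by
      rw [← e3, ← aux_neg, ← Finset.sum_neg_distrib]
      refine Finset.sum_congr rfl fun x _ => ?_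
      rw [show M (-x) = - M x by linarith [hM1 x], show -x + d' = d' - x by ring]; ring
    have m0 : (0:ℤ) ∈ Finset.Icc (-(2*(N:ℤ))) (2*(N:ℤ)) := by rw [Finset.mem_Icc]; omega
    have m1 : d' ∈ Finset.Icc (-(2*(N:ℤ))) (2*(N:ℤ)) := by rw [Finset.mem_Icc]; omega
    have m2 : -d' ∈ Finset.Icc (-(2*(N:ℤ))) (2*(N:ℤ)) := by rw [Finset.mem_Icc]; omega
    rw [Finset.sum_add_distrib, Finset.sum_add_distrib, Finset.sum_add_distrib,
      Finset.sum_ite_eq', Finset.sum_ite_eq', Finset.sum_ite_eq', if_pos m0, if_pos m1, if_pos m2,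
      ← Finset.mul_sum, Finset.sum_sub_distrib, Finset.sum_sub_distrib, Finset.sum_add_distrib,
      ← Finset.mul_sum, ← Finset.mul_sum, e1, e2, e3, e4]
    ring
end

section
/- The kernel admits the representation K̂_M(k,k') = 4 · ∑_{1≤|d|≤2N} ∑_{1≤|d'|≤2N} K_M(d,d') sin²(πdk) sin²(πd'k') for all k, k' ∈ ℝ. -/
open Finset Real

set_option linter.unusedSimpArgs false

def IsOddSupp (N : ℕ) (M : ℤ → ℝ) : Prop :=
  (∀ d : ℤ, M (-d) = - M d) ∧ (∀ d : ℤ, (2*|d| ≤ (N:ℤ) ∨ (N:ℤ) < |d|) → M d = 0)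

lemma IsOddSupp.zero {N : ℕ} {M : ℤ → ℝ} (h : IsOddSupp N M) : M 0 = 0 :=
  h.2 0 (Or.inl (by simp))

lemma IsOddSupp.big {N : ℕ} {M : ℤ → ℝ} (h : IsOddSupp N M) (d : ℤ) (hd : (N:ℤ) < |d|) :
    M d = 0 := h.2 d (Or.inr hd)

lemma sum_neg_Icc (A : ℤ) (f : ℤ → ℝ) :
    ∑ e ∈ Finset.Icc (-A) A, f (-e) = ∑ e ∈ Finset.Icc (-A) A, f e := by
  apply Finset.sum_nbij' (fun e => -e) (fun e => -e)
  · intro a ha; simp only [Finset.mem_Icc] at *; omega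
  · intro a ha; simp only [Finset.mem_Icc] at *; omega
  · intro a _; simp
  · intro a _; simp
  · intro a _; simp

lemma sum_odd_Icc {N : ℕ} {M : ℤ → ℝ} (h : IsOddSupp N M) (A : ℤ) :
    ∑ e ∈ Finset.Icc (-A) A, M e = 0 := by
  have := sum_neg_Icc A M
  simp only [h.1, Finset.sum_neg_distrib] at this
  linarith

lemma sum_shift {N : ℕ} {M : ℤ → ℝ} (h : IsOddSupp N M) (d : ℤ) :
    ∑ e ∈ Finset.Icc (-(2*(N:ℤ))) (2*(N:ℤ)), M d * M (e - d) = 0 := by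
  by_cases hd : (N:ℤ) < |d|
  · simp [h.big d hd]
  rw [← Finset.mul_sum]
  have e1 : ∑ e ∈ Finset.Icc (-(2*(N:ℤ))) (2*(N:ℤ)), M (e - d) = ∑' e : ℤ, M (e - d) := by
    symm
    apply tsum_eq_sum
    intro b hb
    apply h.big
    simp only [Finset.mem_Icc] at hb
    grind
  have e2 : ∑ e ∈ Finset.Icc (-(N:ℤ)) (N:ℤ), M e = ∑' e : ℤ, M e := by
    symm
    apply tsum_eq_sum
    intro b hb
    apply h.big
    simp only [Finset.mem_Icc] at hb
    grind
  have e3 : ∑' e : ℤ, M (e - d) = ∑' e : ℤ, M e := (Equiv.subRight d).tsum_eq M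
  rw [e1, e3, ← e2, sum_odd_Icc h, mul_zero]

lemma Sig_eq {N : ℕ} {M : ℤ → ℝ} (h : IsOddSupp N M) (d : ℤ) :
    Sig N M d = ∑ e ∈ Finset.Icc (-(2*(N:ℤ))) (2*(N:ℤ)), M e * M (d - e) := by
  have e0 : ∑ e ∈ Finset.Icc (-(N:ℤ)) (N:ℤ), M e * M (d - e)
      = ∑ e ∈ Finset.Icc (-(2*(N:ℤ))) (2*(N:ℤ)), M e * M (d - e) := by
    apply Finset.sum_subset
    · intro a ha; simp only [Finset.mem_Icc] at *; omega
    · intro a _ ha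
      rw [h.big a, zero_mul]
      simp only [Finset.mem_Icc] at ha
      grind
  rw [← e0, Sig]
  apply Finset.sum_congr rfl
  intro a _
  have e1 : ∀ b ∈ Finset.Icc (-(N:ℤ)) (N:ℤ),
      (if a + b = d ∧ a ≠ 0 ∧ b ≠ 0 then M a * M b else 0)
      = if d - a = b then M a * M b else 0 := by
    intro b _
    have h0 := h.zero
    by_cases ha : a = 0
    · simp [ha, h0]
    by_cases hb : b = 0
    · simp [hb, h0]
    have : a + b = d ↔ d - a = b := by constructor <;> intro h <;> omega
    simp [ha, hb, this]
  rw [Finset.sum_congr rfl e1, Finset.sum_ite_eq]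
  split_ifs with hm
  · rfl
  · rw [h.big (d - a), mul_zero]
    simp only [Finset.mem_Icc] at hm
    grind

lemma Sig_neg {N : ℕ} {M : ℤ → ℝ} (h : IsOddSupp N M) (d : ℤ) :
    Sig N M (-d) = Sig N M d := by
  rw [Sig_eq h, Sig_eq h, ← sum_neg_Icc]
  apply Finset.sum_congr rfl
  intro e _
  have : -d - -e = -(d - e) := by ring
  rw [this, h.1, h.1]; ring

lemma Sig_plus {N : ℕ} {M : ℤ → ℝ} (h : IsOddSupp N M) (d : ℤ) :
    ∑ e ∈ Finset.Icc (-(2*(N:ℤ))) (2*(N:ℤ)), M e * M (d + e) = - Sig N M d := by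
  rw [Sig_eq h, ← sum_neg_Icc, ← Finset.sum_neg_distrib]
  apply Finset.sum_congr rfl
  intro e _
  rw [h.1, ← sub_eq_add_neg]; ring

lemma Sig_total {N : ℕ} {M : ℤ → ℝ} (h : IsOddSupp N M) :
    ∑ e ∈ Finset.Icc (-(2*(N:ℤ))) (2*(N:ℤ)), Sig N M e = 0 := by
  simp only [Sig_eq h]
  rw [Finset.sum_comm]
  apply Finset.sum_eq_zero
  intro e _
  exact sum_shift h e

lemma sum_sq {N : ℕ} {M : ℤ → ℝ} (h : IsOddSupp N M) :
    ∑ e ∈ Finset.Icc (-(2*(N:ℤ))) (2*(N:ℤ)), M e ^ 2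
      = 2 * ∑ j ∈ Finset.Icc (1:ℤ) N, M j ^ 2 := by
  have e1 : ∑ e ∈ Finset.Icc (1:ℤ) N, M e ^ 2 = ∑ e ∈ Finset.Icc (-(N:ℤ)) (-1), M e ^ 2 := by
    apply Finset.sum_nbij' (fun e => -e) (fun e => -e)
    · intro a ha; simp only [Finset.mem_Icc] at *; omega
    · intro a ha; simp only [Finset.mem_Icc] at *; omega
    · intro a _; simp
    · intro a _; simp
    · intro a _; simp [h.1]
  have e2 : ∑ e ∈ Finset.Icc (1:ℤ) N ∪ Finset.Icc (-(N:ℤ)) (-1), M e ^ 2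
      = ∑ e ∈ Finset.Icc (-(2*(N:ℤ))) (2*(N:ℤ)), M e ^ 2 := by
    apply Finset.sum_subset
    · intro a ha; simp only [Finset.mem_Icc, Finset.mem_union] at *; omega
    · intro a _ ha
      simp only [Finset.mem_Icc, Finset.mem_union] at ha
      by_cases h0 : a = 0
      · simp [h0, h.zero]
      · rw [h.big a (by grind)]; simp
  rw [← e2, Finset.sum_union, ← e1]
  · ring
  · rw [Finset.disjoint_left]
    intro a ha hb
    simp only [Finset.mem_Icc] at *; omega

lemma Sig_zero {N : ℕ} {M : ℤ → ℝ} (h : IsOddSupp N M) :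
    Sig N M 0 = - (2 * ∑ j ∈ Finset.Icc (1:ℤ) N, M j ^ 2) := by
  rw [← sum_sq h, Sig_eq h, ← Finset.sum_neg_distrib]
  apply Finset.sum_congr rfl
  intro e _
  rw [zero_sub, h.1]; ring

lemma Kcoef_zero_left {N : ℕ} {M : ℤ → ℝ} (h : IsOddSupp N M) (e : ℤ) (he : |e| ≤ 2*(N:ℤ)) :
    Kcoef N M 0 e = -(M e ^ 2) - (1/2) * Sig N M e
      + if e = 0 then 2 * ∑ j ∈ Finset.Icc (1:ℤ) N, M j ^ 2 else 0 := by
  by_cases h0 : e = 0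
  · subst h0
    simp [Kcoef, h.zero, Sig_zero h]; ring
  · have h1 : 1 ≤ |e| := Int.one_le_abs h0
    by_cases h2 : |e| ≤ (N:ℤ)
    · simp [Kcoef, h0, h1, h2]
    · have h3 : (N:ℤ) + 1 ≤ |e| := by omega
      simp [Kcoef, h0, h1, h2, h3, he, h.big e (by omega)]

lemma Kcoef_ne_zero {N : ℕ} {M : ℤ → ℝ} (h : IsOddSupp N M) (d e : ℤ) (h0 : d ≠ 0)
    (hd : |d| ≤ 2*(N:ℤ)) (he : |e| ≤ 2*(N:ℤ)) :
    Kcoef N M d e = (1/2) * (M e * M (d - e) + M d * M (e - d) - M e * M (d + e) - M d * M (e - -d))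
      + ((if e = 0 then -(1/2) * Sig N M d else 0)
      + (if e = d then -(1/4) * Sig N M d else 0)
      + (if e = -d then -(1/4) * Sig N M d else 0)) := by
  have hd1 : 1 ≤ |d| := Int.one_le_abs h0
  have hz := h.zero
  by_cases e0 : e = 0
  · subst e0
    have : (0:ℤ) ≠ d := fun h => h0 h.symm
    have t : (0:ℤ) ≠ -d := by omega
    by_cases h2 : |d| ≤ (N:ℤ)
    · simp [Kcoef, h0, h2, hd1, hz, this, h.1]; ring
    · simp [Kcoef, h0, h2, hd1, hz, this, hd, h.big d (by omega)]
  have he1 : 1 ≤ |e| := Int.one_le_abs e0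
  by_cases e1 : e = d
  · subst e1
    have t : e ≠ -e := by omega
    by_cases h2 : 2 * |e| ≤ (N:ℤ)
    · simp [Kcoef, h0, h2, hd1, hd, hz, t, two_mul e]; ring
    · have : M (e + e) = 0 := h.big _ (by grind)
      simp [Kcoef, h0, h2, hd1, hd, hz, t, this]
  by_cases e2 : e = -d
  · subst e2
    have t : -d ≠ d := by omega
    have u : -d - d = -(d + d) := by ring
    have v : M (-d + -d) = -M (d + d) := by rw [← h.1]; congr 1
    by_cases h2 : 2 * |d| ≤ (N:ℤ)
    · simp [Kcoef, h0, h2, hd1, hd, hz, t, two_mul d, u, v, h.1]; ring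
    · have : M (d + d) = 0 := h.big _ (by grind)
      simp [Kcoef, h0, h2, hd1, hd, hz, t, this, u, v, h.1]
  simp only [e0, e1, e2, if_false, add_zero, sub_neg_eq_add]
  have A := h.big d
  have B := h.big e
  have C := h.big (d - e)
  have D := h.big (d + e)
  have E : M (e - d) = - M (d - e) := by rw [← h.1]; congr 1; ring
  rw [add_comm e d, E]
  simp only [Kcoef, h0, e0, e1, e2, hd1, he1, hd, he, false_and, and_false, if_false, true_and,
    and_true, false_or]
  rw [abs_sub_comm e d, add_comm e d, E]
  clear E hz h hd he h0
  split_ifs <;> grind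

lemma Kcoef_zero_right {N : ℕ} {M : ℤ → ℝ} (h : IsOddSupp N M) (d : ℤ)
    (hd : |d| ≤ 2*(N:ℤ)) : Kcoef N M d 0 = Kcoef N M 0 d := by
  by_cases h0 : d = 0
  · rw [h0]
  have h1 : (0:ℤ) ≠ d := fun h => h0 h.symm
  have h2 : (0:ℤ) ≠ -d := by omega
  rw [Kcoef_zero_left h d hd, Kcoef_ne_zero h d 0 h0 hd (by simp)]
  simp [h0, h1, h.1, h.zero]
  ring

lemma Kcoef_symm {N : ℕ} {M : ℤ → ℝ} (h : IsOddSupp N M) (d e : ℤ)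
    (hd : |d| ≤ 2*(N:ℤ)) (he : |e| ≤ 2*(N:ℤ)) :
    Kcoef N M d e = Kcoef N M e d := by
  by_cases h0 : d = 0
  · rw [h0, Kcoef_zero_right h e he]
  by_cases e0 : e = 0
  · rw [e0, Kcoef_zero_right h d hd]
  rw [Kcoef_ne_zero h d e h0 hd he, Kcoef_ne_zero h e d e0 he hd]
  have E : M (e - d) = - M (d - e) := by rw [← h.1]; congr 1; ring
  rw [sub_neg_eq_add, sub_neg_eq_add, add_comm e d, E]
  by_cases e1 : e = d
  · subst e1; ring
  by_cases e2 : e = -d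
  · subst e2
    simp [h0, Sig_neg h]; grind
  have e3 : ¬ d = e := fun h => e1 h.symm
  have e4 : ¬ d = -e := by omega
  simp only [h0, e0, e1, e2, e3, e4, if_false]
  ring

lemma row_sum {N : ℕ} {M : ℤ → ℝ} (h : IsOddSupp N M) (d : ℤ) (hd : |d| ≤ 2*(N:ℤ)) :
    ∑ e ∈ Finset.Icc (-(2*(N:ℤ))) (2*(N:ℤ)), Kcoef N M d e = 0 := by
  have hm : ∀ e ∈ Finset.Icc (-(2*(N:ℤ))) (2*(N:ℤ)), |e| ≤ 2*(N:ℤ) := by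
    intro e he; rw [Finset.mem_Icc] at he; exact abs_le.2 he
  have z0 : (0:ℤ) ∈ Finset.Icc (-(2*(N:ℤ))) (2*(N:ℤ)) := by rw [Finset.mem_Icc]; omega
  by_cases h0 : d = 0
  · subst h0
    rw [Finset.sum_congr rfl (fun e he => Kcoef_zero_left h e (hm e he))]
    rw [Finset.sum_add_distrib, Finset.sum_sub_distrib, Finset.sum_neg_distrib, sum_sq h,
      ← Finset.mul_sum, Sig_total h, Finset.sum_ite_eq', if_pos z0]
    ring
  · rw [Finset.sum_congr rfl (fun e he => Kcoef_ne_zero h d e h0 hd (hm e he))]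
    have z1 : d ∈ Finset.Icc (-(2*(N:ℤ))) (2*(N:ℤ)) := by rw [Finset.mem_Icc]; exact abs_le.1 hd
    have z2 : -d ∈ Finset.Icc (-(2*(N:ℤ))) (2*(N:ℤ)) := by rw [Finset.mem_Icc] at *; omega
    have s2 : ∑ e ∈ Finset.Icc (-(2*(N:ℤ))) (2*(N:ℤ)), M d * M (e - -d) = 0 := by
      have := sum_shift h (-d)
      simpa only [h.1 d, neg_mul, Finset.sum_neg_distrib, neg_eq_zero] using this
    rw [Finset.sum_add_distrib, Finset.sum_add_distrib, Finset.sum_add_distrib,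
      Finset.sum_ite_eq', Finset.sum_ite_eq', Finset.sum_ite_eq', if_pos z0, if_pos z1, if_pos z2,
      ← Finset.mul_sum, Finset.sum_sub_distrib, Finset.sum_sub_distrib, Finset.sum_add_distrib,
      sum_shift h d, s2, Sig_plus h d, ← Sig_eq h d]
    ring

lemma sum_expand (s : Finset ℤ) (K : ℤ → ℤ → ℝ) (f g : ℤ → ℝ)
    (h1 : ∀ d ∈ s, ∑ e ∈ s, K d e = 0) (h2 : ∀ e ∈ s, ∑ d ∈ s, K d e = 0) :
    ∑ d ∈ s, ∑ e ∈ s, K d e * (1 - 2 * f d) * (1 - 2 * g e)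
      = 4 * ∑ d ∈ s, ∑ e ∈ s, K d e * f d * g e := by
  have a1 : ∑ d ∈ s, ∑ e ∈ s, K d e * (1 - 2 * f d) = 0 := by
    apply Finset.sum_eq_zero
    intro d hd
    rw [← Finset.sum_mul, h1 d hd, zero_mul]
  have a2 : ∑ d ∈ s, ∑ e ∈ s, K d e * (2 * g e) = 0 := by
    rw [Finset.sum_comm]
    apply Finset.sum_eq_zero
    intro d hd
    rw [← Finset.sum_mul, h2 d hd, zero_mul]
  have a3 : ∑ d ∈ s, ∑ e ∈ s, K d e * (1 - 2 * f d) * (1 - 2 * g e)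
      = ∑ d ∈ s, ∑ e ∈ s, K d e * (1 - 2 * f d) - ∑ d ∈ s, ∑ e ∈ s, K d e * (2 * g e)
        + 4 * ∑ d ∈ s, ∑ e ∈ s, K d e * f d * g e := by
    simp only [Finset.mul_sum, ← Finset.sum_sub_distrib, ← Finset.sum_add_distrib]
    refine Finset.sum_congr rfl fun d _ => Finset.sum_congr rfl fun e _ => ?_
    ring
  rw [a3, a1, a2]; ring

lemma cos_eq_sin_sq (d : ℤ) (k : ℝ) :
    Real.cos (2*π*d*k) = 1 - 2 * Real.sin (π*d*k) ^ 2 := by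
  have : 2*π*d*k = 2 * (π*d*k) := by ring
  rw [this, Real.cos_two_mul, Real.cos_sq']; ring



/-- **Sine-squared representation of the kernel:**
`K̂_M(k,k') = 4 ∑_{1≤|d|≤2N} ∑_{1≤|d'|≤2N} K_M(d,d') sin²(πdk) sin²(πd'k')`. -/
theorem Khat_eq_sin_sq_repr (N : ℕ) (hN : 1 ≤ N) (M : ℤ → ℝ)
    (hM1 : ∀ d : ℤ, M d + M (-d) = 0)
    (hM2 : ∀ d : ℤ, (2*|d| ≤ (N:ℤ) ∨ (N:ℤ) < |d|) → M d = 0)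
    (k k' : ℝ) :
    Khat N M k k' =
      4 * ∑ d ∈ (Finset.Icc (-(2*(N:ℤ))) (2*(N:ℤ))).erase 0,
            ∑ d' ∈ (Finset.Icc (-(2*(N:ℤ))) (2*(N:ℤ))).erase 0,
              Kcoef N M d d' * Real.sin (π*d*k) ^ 2 * Real.sin (π*d'*k') ^ 2 := by
  have h : IsOddSupp N M := ⟨fun d => by linarith [hM1 d], hM2⟩
  have hm : ∀ e ∈ Finset.Icc (-(2*(N:ℤ))) (2*(N:ℤ)), |e| ≤ 2*(N:ℤ) := by
    intro e he; rw [Finset.mem_Icc] at he; exact abs_le.2 he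
  have r1 : ∀ d ∈ Finset.Icc (-(2*(N:ℤ))) (2*(N:ℤ)),
      ∑ e ∈ Finset.Icc (-(2*(N:ℤ))) (2*(N:ℤ)), Kcoef N M d e = 0 :=
    fun d hd => row_sum h d (hm d hd)
  have r2 : ∀ e ∈ Finset.Icc (-(2*(N:ℤ))) (2*(N:ℤ)),
      ∑ d ∈ Finset.Icc (-(2*(N:ℤ))) (2*(N:ℤ)), Kcoef N M d e = 0 := by
    intro e he
    rw [Finset.sum_congr rfl (fun d hd => Kcoef_symm h d e (hm d hd) (hm e he))]
    exact r1 e he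
  rw [Finset.sum_erase]
  · simp only [Khat, cos_eq_sin_sq]
    rw [sum_expand _ _ (fun d : ℤ => Real.sin (π*d*k) ^ 2) (fun d : ℤ => Real.sin (π*d*k') ^ 2)
      r1 r2]
    congr 1
    refine Finset.sum_congr rfl fun d _ => ?_
    rw [Finset.sum_erase]
    simp
  · simp
end

section
/- Define L_M(d₁,d₂) = ∑_{d=d₁+1}^{2N} ∑_{d'=d₂+1}^{2N} K_M(d,d') for 0 ≤ d₁, d₂ ≤ 2N−1. Then for all k, k' ∈ ℝ, K̂_M(k,k') = 16 sin²(πk) sin²(πk') · ∑_{d₁=0}^{2N−1} ∑_{d₂=0}^{2N−1} L_M(d₁,d₂) U_{2d₁}(cos(πk)) U_{2d₂}(cos(πk')), where U_n denotes the n-th Chebyshev polynomial of the second kind (sin((n+1)θ) = sin(θ)U_n(cos θ)). -/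
open Finset Real

lemma kh_sin_sq (x : ℝ) (m : ℕ) :
    Real.sin (m * x) ^ 2 = Real.sin x ^ 2 *
      ∑ j ∈ Finset.range m, (Polynomial.Chebyshev.U ℝ (2*(j:ℤ))).eval (Real.cos x) := by
  induction m with
  | zero => simp
  | succ m ih =>
    rw [Finset.sum_range_succ, mul_add, ← ih]
    have h := Polynomial.Chebyshev.U_real_cos x (2*(m:ℤ))
    have h2 : Real.sin x ^ 2 * (Polynomial.Chebyshev.U ℝ (2*(m:ℤ))).eval (Real.cos x)
        = Real.sin x * Real.sin (m*x + (m*x + x)) := by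
      rw [show (m:ℝ)*x + (m*x + x) = ((2*(m:ℤ) : ℤ) + 1) * x by push_cast; ring, ← h]; ring
    rw [h2]
    push_cast
    rw [add_mul, one_mul, Real.sin_add, Real.sin_add (m*x) (m*x+x), Real.sin_add, Real.cos_add]
    have e1 := Real.sin_sq_add_cos_sq x
    have e2 := Real.sin_sq_add_cos_sq (m*x)
    generalize Real.sin x = s at *
    generalize Real.cos x = c at *
    generalize Real.sin (m*x) = S at *
    generalize Real.cos (m*x) = C at *
    have : c^2 = 1 - s^2 := by linarith
    have : C^2 = 1 - S^2 := by linarith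
    grind

lemma kh_sum_symm (n : ℕ) (f : ℤ → ℝ) (hf : ∀ d : ℤ, |d| ≤ n → f (-d) = f d) :
    ∑ d ∈ Finset.Icc (-(n:ℤ)) n, f d = f 0 + 2 * ∑ d ∈ Finset.Icc (1:ℤ) n, f d := by
  have h1 : Finset.Icc (-(n:ℤ)) n = (Finset.Icc (-(n:ℤ)) (-1) ∪ {0}) ∪ Finset.Icc 1 (n:ℤ) := by
    ext x; simp; omega
  have h3 : ∑ d ∈ Finset.Icc (-(n:ℤ)) (-1), f d = ∑ d ∈ Finset.Icc (1:ℤ) n, f d := by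
    refine Finset.sum_nbij' (fun d => -d) (fun d => -d) ?_ ?_ ?_ ?_ ?_
    · intro a; simp; omega
    · intro a; simp; omega
    · simp
    · simp
    · intro a ha
      simp at ha
      exact (hf a (by rw [abs_le]; omega)).symm
  rw [h1, Finset.sum_union, Finset.sum_union, h3]
  · simp; ring
  · rw [Finset.disjoint_left]; intro a; simp; omega
  · rw [Finset.disjoint_left]; intro a; simp; omega

lemma kh_one (n : ℕ) (a : ℤ → ℝ) (ha : ∀ d : ℤ, |d| ≤ n → a (-d) = a d)
    (h0 : ∑ d ∈ Finset.Icc (-(n:ℤ)) n, a d = 0) (k : ℝ) :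
    ∑ d ∈ Finset.Icc (-(n:ℤ)) n, a d * Real.cos (2*π*d*k) =
      -4 * Real.sin (π*k) ^ 2 * ∑ j ∈ Finset.range n,
        (∑ d ∈ Finset.Icc ((j:ℤ)+1) n, a d) *
          (Polynomial.Chebyshev.U ℝ (2*(j:ℤ))).eval (Real.cos (π*k)) := by
  have e : ∑ d ∈ Finset.Icc (-(n:ℤ)) n, a d * Real.cos (2*π*d*k)
      = ∑ d ∈ Finset.Icc (-(n:ℤ)) n, a d * (-2 * Real.sin (d * (π*k))^2) := by
    rw [← sub_zero (∑ d ∈ Finset.Icc (-(n:ℤ)) n, a d * Real.cos (2*π*d*k)), ← h0,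
      ← Finset.sum_sub_distrib]
    refine Finset.sum_congr rfl fun d _ => ?_
    rw [show 2*π*(d:ℝ)*k = 2 * (d * (π*k)) by ring, Real.cos_two_mul, Real.cos_sq']
    ring
  rw [e, kh_sum_symm]
  · have e2 : ∀ d ∈ Finset.Icc (1:ℤ) n, a d * (-2 * Real.sin (d * (π*k))^2)
        = -2 * Real.sin (π*k)^2 * ∑ j ∈ Finset.range n, if (j:ℤ)+1 ≤ d then
          a d * (Polynomial.Chebyshev.U ℝ (2*(j:ℤ))).eval (Real.cos (π*k)) else 0 := by
      intro d hd
      rw [Finset.mem_Icc] at hd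
      obtain ⟨m, rfl⟩ := Int.eq_ofNat_of_zero_le (by omega : 0 ≤ d)
      have := kh_sin_sq (π*k) m
      rw [Int.cast_natCast, this, ← Finset.sum_filter]
      have : (Finset.range n).filter (fun j : ℕ => (j:ℤ)+1 ≤ (m:ℤ)) = Finset.range m := by
        ext x; simp; omega
      rw [this, ← Finset.mul_sum]; ring
    rw [Finset.sum_congr rfl e2, ← Finset.mul_sum, Finset.sum_comm]
    have e3 : ∀ j ∈ Finset.range n, (∑ d ∈ Finset.Icc (1:ℤ) n, if (j:ℤ)+1 ≤ d then
          a d * (Polynomial.Chebyshev.U ℝ (2*(j:ℤ))).eval (Real.cos (π*k)) else 0)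
        = (∑ d ∈ Finset.Icc ((j:ℤ)+1) n, a d) *
          (Polynomial.Chebyshev.U ℝ (2*(j:ℤ))).eval (Real.cos (π*k)) := by
      intro j _
      rw [← Finset.sum_filter, ← Finset.sum_mul]
      congr 2
      ext x; simp; omega
    rw [Finset.sum_congr rfl e3]
    simp; ring
  · intro d hd
    rw [ha d hd]
    rw [Int.cast_neg, neg_mul (d:ℝ) (π*k), Real.sin_neg, neg_sq]

/-- Off-diagonal part of the kernel. -/
noncomputable def khF (M : ℤ → ℝ) (d d' : ℤ) : ℝ :=
  (1/2) * (M d' * M (d - d') + M d * M (d' - d) - M d' * M (d + d') - M d * M (d + d'))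

/-- Uniform expression for the kernel. -/
noncomputable def khG (N : ℕ) (M : ℤ → ℝ) (d d' : ℤ) : ℝ :=
  khF M d d' - (if d' = d then (1/4) * Sig N M d else 0) - (if d' = -d then (1/4) * Sig N M d else 0)
    - (if d' = 0 then (1/2) * Sig N M d else 0) - (if d = 0 then (1/2) * Sig N M d' else 0)

lemma kh_shift (N : ℕ) (M : ℤ → ℝ)
    (hM1 : ∀ d : ℤ, M d + M (-d) = 0)
    (hM2 : ∀ d : ℤ, (2*|d| ≤ (N:ℤ) ∨ (N:ℤ) < |d|) → M d = 0)
    (d : ℤ) (hd : |d| ≤ N) :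
    ∑ x ∈ Finset.Icc (-(2*(N:ℤ))) (2*N), M (x - d) = 0 := by
  rw [abs_le] at hd
  have h1 : ∑ x ∈ Finset.Icc (-(2*(N:ℤ))) (2*N), M (x - d) = ∑ x ∈ Finset.Icc (-(N:ℤ)) N, M x := by
    symm
    refine Finset.sum_of_injOn (fun x => x + d) ?_ ?_ ?_ ?_
    · intro x _ y _; simp
    · intro x; simp; omega
    · intro x hx hx'
      apply hM2
      right
      by_contra hc
      apply hx'
      rw [not_lt, abs_le] at hc
      exact ⟨x - d, by simp; omega, by simp⟩
    · intro x _; simp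
  rw [h1]
  have h2 : ∑ x ∈ Finset.Icc (-(N:ℤ)) N, M x = ∑ x ∈ Finset.Icc (-(N:ℤ)) N, M (-x) := by
    refine Finset.sum_nbij' (fun d => -d) (fun d => -d) ?_ ?_ ?_ ?_ ?_
    · intro a; simp; omega
    · intro a; simp; omega
    · simp
    · simp
    · simp
  have h3 : ∑ x ∈ Finset.Icc (-(N:ℤ)) N, M x + ∑ x ∈ Finset.Icc (-(N:ℤ)) N, M (-x) = 0 := by
    rw [← Finset.sum_add_distrib]; exact Finset.sum_eq_zero fun x _ => hM1 x
  linarith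

lemma kh_Sig (N : ℕ) (M : ℤ → ℝ)
    (hM2 : ∀ d : ℤ, (2*|d| ≤ (N:ℤ) ∨ (N:ℤ) < |d|) → M d = 0)
    (d : ℤ) :
    Sig N M d = ∑ x ∈ Finset.Icc (-(2*(N:ℤ))) (2*N), M x * M (d - x) := by
  have h0 : M 0 = 0 := hM2 0 (by simp)
  have : Sig N M d = ∑ x ∈ Finset.Icc (-(N:ℤ)) N, M x * M (d - x) := by
    unfold Sig
    refine Finset.sum_congr rfl fun x _ => ?_
    by_cases hx : |d - x| ≤ N
    · rw [Finset.sum_eq_single (d - x)]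
      · by_cases h1 : x = 0
        · simp [h1, h0]
        · by_cases h2 : d - x = 0
          · simp [h2, h0]
          · simp [h1, h2]
      · intro b _ hb
        rw [if_neg]; intro h; apply hb; omega
      · intro h; exfalso; apply h; rw [abs_le] at hx; simpa using hx
    · rw [hM2 (d - x) (by right; omega), mul_zero]
      refine Finset.sum_eq_zero fun y hy => ?_
      rw [if_neg]; intro h; apply hx
      rw [Finset.mem_Icc] at hy; rw [abs_le]; omega
  rw [this]
  refine Finset.sum_subset ?_ ?_
  · intro x; simp; omega
  · intro x _ hx
    rw [hM2 x, zero_mul]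
    right
    by_contra hc
    rw [not_lt, abs_le] at hc
    apply hx; simpa using hc

lemma kh_refl (n : ℤ) (f : ℤ → ℝ) :
    ∑ x ∈ Finset.Icc (-n) n, f x = ∑ x ∈ Finset.Icc (-n) n, f (-x) := by
  refine Finset.sum_nbij' (fun d => -d) (fun d => -d) ?_ ?_ ?_ ?_ ?_
  · intro a; simp; omega
  · intro a; simp; omega
  · simp
  · simp
  · simp

lemma kh_Sig_neg (N : ℕ) (M : ℤ → ℝ)
    (hM1 : ∀ d : ℤ, M d + M (-d) = 0)
    (hM2 : ∀ d : ℤ, (2*|d| ≤ (N:ℤ) ∨ (N:ℤ) < |d|) → M d = 0)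
    (d : ℤ) : Sig N M (-d) = Sig N M d := by
  rw [kh_Sig N M hM2, kh_Sig N M hM2, kh_refl]
  refine Finset.sum_congr rfl fun x _ => ?_
  have h1 := hM1 x
  have h2 := hM1 (d - x)
  rw [show -d - -x = -(d-x) by ring]
  rw [show M (-x) = - M x by linarith, show M (-(d-x)) = - M (d-x) by linarith]; ring

lemma kh_Sig_zero (N : ℕ) (M : ℤ → ℝ)
    (hM1 : ∀ d : ℤ, M d + M (-d) = 0)
    (hM2 : ∀ d : ℤ, (2*|d| ≤ (N:ℤ) ∨ (N:ℤ) < |d|) → M d = 0)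
    : Sig N M 0 = -2 * ∑ j ∈ Finset.Icc (1:ℤ) N, M j ^ 2 := by
  have h0 : M 0 = 0 := hM2 0 (by simp)
  have odd : ∀ x, M (-x) = - M x := fun x => by linarith [hM1 x]
  rw [kh_Sig N M hM2]
  have := kh_sum_symm (2*N) (fun x => M x * M (0 - x)) (by intro d _; simp [odd])
  push_cast at this
  rw [this]
  have h : ∑ j ∈ Finset.Icc (1:ℤ) N, M j ^ 2 = ∑ j ∈ Finset.Icc (1:ℤ) (2*N), M j ^ 2 := by
    refine Finset.sum_subset ?_ ?_
    · intro x; simp; omega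
    · intro x hx hx'
      simp at hx hx'
      rw [hM2 x]; · simp
      right; rw [lt_abs]; left; omega
  rw [h]
  simp [h0, odd, pow_two]

lemma kh_sum_Sig (N : ℕ) (M : ℤ → ℝ)
    (hM1 : ∀ d : ℤ, M d + M (-d) = 0)
    (hM2 : ∀ d : ℤ, (2*|d| ≤ (N:ℤ) ∨ (N:ℤ) < |d|) → M d = 0)
    : ∑ d ∈ Finset.Icc (-(2*(N:ℤ))) (2*N), Sig N M d = 0 := by
  rw [Finset.sum_congr rfl fun d _ => kh_Sig N M hM2 d, Finset.sum_comm]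
  refine Finset.sum_eq_zero fun x _ => ?_
  rw [← Finset.mul_sum]
  by_cases hx : |x| ≤ N
  · rw [kh_shift N M hM1 hM2 x hx, mul_zero]
  · rw [hM2 x (by right; omega), zero_mul]

lemma kh_G_neg (N : ℕ) (M : ℤ → ℝ)
    (hM1 : ∀ d : ℤ, M d + M (-d) = 0)
    (hM2 : ∀ d : ℤ, (2*|d| ≤ (N:ℤ) ∨ (N:ℤ) < |d|) → M d = 0)
    (d d' : ℤ) : khG N M d (-d') = khG N M d d' := by
  have odd : ∀ x, M (-x) = - M x := fun x => by linarith [hM1 x]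
  unfold khG khF
  rw [kh_Sig_neg N M hM1 hM2, odd, show d - -d' = d + d' by ring,
    show -d' - d = -(d+d') by ring, show d + -d' = d - d' by ring, odd,
    show d' - d = -(d - d') by ring, odd]
  have i1 : (-d' = d) = (d' = -d) := propext ⟨fun h => by omega, fun h => by omega⟩
  have i2 : (-d' = -d) = (d' = d) := propext ⟨fun h => by omega, fun h => by omega⟩
  have i3 : (-d' = 0) = (d' = 0) := propext ⟨fun h => by omega, fun h => by omega⟩
  simp only [i1, i2, i3]
  ring

lemma kh_G_symm (N : ℕ) (M : ℤ → ℝ)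
    (hM1 : ∀ d : ℤ, M d + M (-d) = 0)
    (hM2 : ∀ d : ℤ, (2*|d| ≤ (N:ℤ) ∨ (N:ℤ) < |d|) → M d = 0)
    (d d' : ℤ) : khG N M d d' = khG N M d' d := by
  unfold khG khF
  have h1 : (if d' = d then (1/4) * Sig N M d else 0) = (if d = d' then (1/4) * Sig N M d' else 0) := by
    by_cases h : d = d'
    · simp [h]
    · simp [h, Ne.symm h]
  have h2 : (if d' = -d then (1/4) * Sig N M d else 0) = (if d = -d' then (1/4) * Sig N M d' else 0) := by
    by_cases h : d = -d'
    · simp [h, kh_Sig_neg N M hM1 hM2]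
    · rw [if_neg h, if_neg (by omega)]
  rw [h1, h2, add_comm d d']
  ring

lemma kh_G_sum (N : ℕ) (M : ℤ → ℝ)
    (hM1 : ∀ d : ℤ, M d + M (-d) = 0)
    (hM2 : ∀ d : ℤ, (2*|d| ≤ (N:ℤ) ∨ (N:ℤ) < |d|) → M d = 0)
    (d : ℤ) (hd : |d| ≤ 2*N) :
    ∑ d' ∈ Finset.Icc (-(2*(N:ℤ))) (2*N), khG N M d d' = 0 := by
  have odd : ∀ x, M (-x) = - M x := fun x => by linarith [hM1 x]
  rw [abs_le] at hd
  unfold khG khF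
  simp only [Finset.sum_sub_distrib, ← Finset.mul_sum, Finset.sum_add_distrib]
  rw [Finset.sum_ite_eq', Finset.sum_ite_eq', Finset.sum_ite_eq', if_pos (by simp; omega),
    if_pos (by simp; omega), if_pos (by simp), ← kh_Sig N M hM2]
  have h3 : ∑ x ∈ Finset.Icc (-(2*(N:ℤ))) (2*N), M x * M (d + x) = - Sig N M d := by
    rw [kh_refl, kh_Sig N M hM2, ← Finset.sum_neg_distrib]
    refine Finset.sum_congr rfl fun x _ => ?_
    rw [odd, ← sub_eq_add_neg]; ring
  have h4 : M d * ∑ x ∈ Finset.Icc (-(2*(N:ℤ))) (2*N), M (x - d) = 0 := by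
    by_cases hx : |d| ≤ N
    · rw [kh_shift N M hM1 hM2 d hx, mul_zero]
    · rw [hM2 d (by right; omega), zero_mul]
  have h5 : M d * ∑ x ∈ Finset.Icc (-(2*(N:ℤ))) (2*N), M (d + x) = 0 := by
    by_cases hx : |d| ≤ N
    · have := kh_shift N M hM1 hM2 (-d) (by simpa using hx)
      simp only [sub_neg_eq_add] at this
      simp only [add_comm d, this, mul_zero]
    · rw [hM2 d (by right; omega), zero_mul]
  have h6 : ∑ x ∈ Finset.Icc (-(2*(N:ℤ))) (2*N), (if d = 0 then (1/2) * Sig N M x else 0) = 0 := by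
    by_cases h : d = 0
    · simp only [h, if_true, ← Finset.mul_sum, kh_sum_Sig N M hM1 hM2, mul_zero]
    · simp [h]
  rw [h3, h4, h5, h6]; ring

lemma kh_eq (N : ℕ) (M : ℤ → ℝ)
    (hM1 : ∀ d : ℤ, M d + M (-d) = 0)
    (hM2 : ∀ d : ℤ, (2*|d| ≤ (N:ℤ) ∨ (N:ℤ) < |d|) → M d = 0)
    (d d' : ℤ) (hd : |d| ≤ 2*N) (hd' : |d'| ≤ 2*N) :
    Kcoef N M d d' = khG N M d d' := by
  have h0 : M 0 = 0 := hM2 0 (by simp)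
  have odd : ∀ x, M (-x) = - M x := fun x => by linarith [hM1 x]
  have big : ∀ x, ¬ |x| ≤ (N:ℤ) → M x = 0 := fun x hx => hM2 x (by right; omega)
  have e1 : M (d' - d) = - M (d - d') := by rw [← odd]; congr 1; ring
  by_cases z : d = 0
  · subst z
    by_cases z' : d' = 0
    · subst z'
      simp [Kcoef, khG, khF, h0, kh_Sig_zero N M hM1 hM2]
      ring
    · have p : 1 ≤ |d'| := Int.one_le_abs z'
      by_cases b : |d'| ≤ N
      · simp [Kcoef, khG, khF, h0, z', p, b, odd]; ring
      · have b2 : (N:ℤ) + 1 ≤ |d'| := by omega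
        simp [Kcoef, khG, khF, h0, z', p, b, b2, hd', odd, big d' b]
  · have q : 1 ≤ |d| := Int.one_le_abs z
    by_cases z' : d' = 0
    · subst z'
      by_cases b : |d| ≤ N
      · simp [Kcoef, khG, khF, h0, z, Ne.symm z, q, b, odd]; ring
      · have b2 : (N:ℤ) + 1 ≤ |d| := by omega
        simp [Kcoef, khG, khF, h0, z, Ne.symm z, q, b, b2, hd, odd, big d b]
    · have p : 1 ≤ |d'| := Int.one_le_abs z'
      by_cases c : d' = d ∨ d' = -d
      · have m : M d * M (2*d) = 0 := by
          by_cases h : 2*|d| ≤ (N:ℤ)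
          · rw [hM2 d (Or.inl h), zero_mul]
          · rw [hM2 (2*d), mul_zero]; right; rw [abs_mul]; simpa using h
        have lhs : Kcoef N M d d' = -(1/4) * Sig N M d := by
          simp [Kcoef, z, z', c, q, hd, m]
        rw [lhs]
        rcases c with rfl | rfl
        · have : ¬ d' = -d' := by omega
          rw [two_mul] at m
          simp [khG, khF, z, this, h0, m]
        · have : ¬ -d = d := by omega
          rw [two_mul] at m
          have e : M (-d - d) = - M (d + d) := by rw [← odd]; congr 1; ring
          simp [khG, khF, z, this, h0, m, e, odd]
      · have c1 : d' ≠ d := fun h => c (Or.inl h)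
        have c2 : d' ≠ -d := fun h => c (Or.inr h)
        have rhs : khG N M d d' = khF M d d' := by simp [khG, z, z', c1, c2]
        rw [rhs]
        have e2 : |d' - d| = |d - d'| := abs_sub_comm _ _
        unfold Kcoef khF
        rw [if_neg (by tauto), if_neg (by tauto), if_neg (by tauto), if_neg (by tauto),
          if_neg (by tauto), if_neg (by tauto), e1, e2, add_comm d' d]
        have both : |d - d'| ≤ (N:ℤ) → |d + d'| ≤ (N:ℤ) → |d| ≤ (N:ℤ) ∧ |d'| ≤ (N:ℤ) := by
          intro s t
          simp only [abs_le] at s t ⊢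
          omega
        by_cases s : |d - d'| ≤ (N:ℤ) <;> by_cases t : |d + d'| ≤ (N:ℤ) <;>
        by_cases b : |d| ≤ (N:ℤ) <;> by_cases b' : |d'| ≤ (N:ℤ) <;>
        first
        | exact absurd (both s t).1 b
        | exact absurd (both s t).2 b'
        | (simp only [← not_le, s, t, b, b', p, q, hd, hd', big, not_true_eq_false,
            not_false_eq_true, and_true, true_and, and_false, false_and, if_true, if_false,
            not_false_iff]
           try ring)

/-- **Chebyshev representation of the kernel:** with
`L_M(d₁,d₂) = ∑_{d=d₁+1}^{2N} ∑_{d'=d₂+1}^{2N} K_M(d,d')`, one has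
`K̂_M(k,k') = 16 sin²(πk) sin²(πk') ∑_{d₁,d₂=0}^{2N−1} L_M(d₁,d₂)
U_{2d₁}(cos πk) U_{2d₂}(cos πk')`. -/
theorem Khat_eq_chebyshev_repr (N : ℕ) (hN : 1 ≤ N) (M : ℤ → ℝ)
    (hM1 : ∀ d : ℤ, M d + M (-d) = 0)
    (hM2 : ∀ d : ℤ, (2*|d| ≤ (N:ℤ) ∨ (N:ℤ) < |d|) → M d = 0)
    (k k' : ℝ) :
    Khat N M k k' =
      16 * Real.sin (π*k) ^ 2 * Real.sin (π*k') ^ 2 *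
        ∑ d₁ ∈ Finset.range (2*N), ∑ d₂ ∈ Finset.range (2*N),
          (∑ d ∈ Finset.Icc ((d₁:ℤ)+1) (2*(N:ℤ)),
            ∑ d' ∈ Finset.Icc ((d₂:ℤ)+1) (2*(N:ℤ)), Kcoef N M d d') *
          (Polynomial.Chebyshev.U ℝ (2*(d₁:ℤ))).eval (Real.cos (π*k)) *
          (Polynomial.Chebyshev.U ℝ (2*(d₂:ℤ))).eval (Real.cos (π*k')) := by
  have hmem : ∀ d ∈ Finset.Icc (-(2*(N:ℤ))) (2*(N:ℤ)), |d| ≤ 2*(N:ℤ) := by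
    intro d hd; rw [abs_le]; simpa using hd
  have hmem2 : ∀ j : ℕ, ∀ d ∈ Finset.Icc ((j:ℤ)+1) (2*(N:ℤ)), |d| ≤ 2*(N:ℤ) := by
    intro j d hd; rw [Finset.mem_Icc] at hd; rw [abs_le]; omega
  have key := kh_eq N M hM1 hM2
  have row : ∀ d : ℤ, |d| ≤ 2*(N:ℤ) →
      ∑ d' ∈ Finset.Icc (-(2*(N:ℤ))) (2*(N:ℤ)), khG N M d d' * Real.cos (2*π*d'*k') =
      -4 * Real.sin (π*k') ^ 2 * ∑ j ∈ Finset.range (2*N),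
        (∑ d' ∈ Finset.Icc ((j:ℤ)+1) (2*(N:ℤ)), khG N M d d') *
          (Polynomial.Chebyshev.U ℝ (2*(j:ℤ))).eval (Real.cos (π*k')) := by
    intro d hd
    have := kh_one (2*N) (fun d' => khG N M d d') (fun d' _ => kh_G_neg N M hM1 hM2 d d')
      (by push_cast; exact kh_G_sum N M hM1 hM2 d hd) k'
    push_cast at this
    exact this
  have col := kh_one (2*N)
    (fun d => ∑ d' ∈ Finset.Icc (-(2*(N:ℤ))) (2*(N:ℤ)), khG N M d d' * Real.cos (2*π*d'*k'))
    (by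
      intro d _
      refine Finset.sum_congr rfl fun d' _ => ?_
      rw [kh_G_symm N M hM1 hM2, kh_G_neg N M hM1 hM2, kh_G_symm N M hM1 hM2])
    (by
      push_cast
      rw [Finset.sum_comm]
      refine Finset.sum_eq_zero fun d' hd' => ?_
      rw [← Finset.sum_mul, Finset.sum_congr rfl fun d _ => kh_G_symm N M hM1 hM2 d d',
        kh_G_sum N M hM1 hM2 d' (hmem d' hd'), zero_mul]) k
  push_cast at col
  have lhs : Khat N M k k' = ∑ d ∈ Finset.Icc (-(2*(N:ℤ))) (2*(N:ℤ)),
      (∑ d' ∈ Finset.Icc (-(2*(N:ℤ))) (2*(N:ℤ)), khG N M d d' * Real.cos (2*π*d'*k')) *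
        Real.cos (2*π*d*k) := by
    unfold Khat
    refine Finset.sum_congr rfl fun d hd => ?_
    rw [Finset.sum_mul]
    refine Finset.sum_congr rfl fun d' hd' => ?_
    rw [key d d' (hmem d hd) (hmem d' hd')]; ring
  rw [lhs, col, Finset.mul_sum, Finset.mul_sum]
  refine Finset.sum_congr rfl fun j₁ _ => ?_
  rw [Finset.sum_congr rfl fun d hd => row d (hmem2 j₁ d hd), ← Finset.mul_sum, Finset.sum_comm]
  have fin : ∀ j₂ ∈ Finset.range (2*N),
      (∑ d ∈ Finset.Icc ((j₁:ℤ)+1) (2*(N:ℤ)),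
        ∑ d' ∈ Finset.Icc ((j₂:ℤ)+1) (2*(N:ℤ)), Kcoef N M d d') *
          (Polynomial.Chebyshev.U ℝ (2*(j₁:ℤ))).eval (Real.cos (π*k)) *
          (Polynomial.Chebyshev.U ℝ (2*(j₂:ℤ))).eval (Real.cos (π*k')) =
      (∑ d ∈ Finset.Icc ((j₁:ℤ)+1) (2*(N:ℤ)),
        (∑ d' ∈ Finset.Icc ((j₂:ℤ)+1) (2*(N:ℤ)), khG N M d d') *
          (Polynomial.Chebyshev.U ℝ (2*(j₂:ℤ))).eval (Real.cos (π*k'))) *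
          (Polynomial.Chebyshev.U ℝ (2*(j₁:ℤ))).eval (Real.cos (π*k)) := by
    intro j₂ _
    rw [← Finset.sum_mul, Finset.sum_congr rfl fun d hd => Finset.sum_congr rfl fun d' hd' =>
      key d d' (hmem2 j₁ d hd) (hmem2 j₂ d' hd')]
    ring
  rw [Finset.sum_congr rfl fin, ← Finset.sum_mul]
  ring
end

section
/- (Drift identity for the generator.) Let N ≥ 1 and M : ℤ → ℝ satisfy (M1) and (M2), and let K_M be the associated kernel coefficients. Then for every α : ℤ → ℝ and every n ∈ ℤ: ∑_{1≤|d₁|≤N} ∑_{1≤|d₂|≤N} M(d₁) M(d₂) α_{n+d₁+d₂} + ∑_{1≤|d|≤N} M(d)² (α_{n+d} − 2α_n + α_{n−d}) = −2 ∑_{|d|≤2N} K_M(d,0) α_{n+d}. -/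
open Finset Real

lemma sum_Icc_symm (N : ℕ) (f : ℤ → ℝ) :
    ∑ d ∈ (Finset.Icc (-(N:ℤ)) (N:ℤ)).erase 0, f d
      = ∑ d ∈ Finset.Icc (1:ℤ) N, f d + ∑ d ∈ Finset.Icc (1:ℤ) N, f (-d) := by
  have h2 : ∑ d ∈ Finset.Icc (1:ℤ) N, f (-d) = ∑ d ∈ Finset.Icc (-(N:ℤ)) (-1), f d := by
    refine Finset.sum_bij' (fun d _ => -d) (fun d _ => -d) ?_ ?_ ?_ ?_ ?_ <;>
      simp only [Finset.mem_Icc] <;> intros <;> first | omega | simp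
  rw [h2, ← Finset.sum_union]
  · apply Finset.sum_congr _ (fun _ _ => rfl)
    ext d
    simp only [Finset.mem_erase, Finset.mem_Icc, Finset.mem_union]
    omega
  · rw [Finset.disjoint_left]
    intro d
    simp only [Finset.mem_Icc]
    omega

lemma Sig_erase (N : ℕ) (M : ℤ → ℝ) (d : ℤ) :
    Sig N M d = ∑ d₁ ∈ (Finset.Icc (-(N:ℤ)) N).erase 0,
      ∑ d₂ ∈ (Finset.Icc (-(N:ℤ)) N).erase 0, if d₁ + d₂ = d then M d₁ * M d₂ else 0 := by
  unfold Sig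
  rw [← Finset.sum_erase_add (Finset.Icc (-(N:ℤ)) N) _
    (show (0:ℤ) ∈ Finset.Icc (-(N:ℤ)) N by simp)]
  simp only [ne_eq, not_true_eq_false, false_and, and_false, if_false, Finset.sum_const_zero,
    add_zero]
  apply Finset.sum_congr rfl
  intro a ha
  rw [← Finset.sum_erase_add (Finset.Icc (-(N:ℤ)) N) _
    (show (0:ℤ) ∈ Finset.Icc (-(N:ℤ)) N by simp)]
  simp only [not_true_eq_false, and_false, if_false, add_zero]
  apply Finset.sum_congr rfl
  intro b hb
  simp [Finset.ne_of_mem_erase ha, Finset.ne_of_mem_erase hb]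

lemma sum_Sig (N : ℕ) (M : ℤ → ℝ) (α : ℤ → ℝ) (n : ℤ) :
    ∑ d ∈ Finset.Icc (-(2*(N:ℤ))) (2*(N:ℤ)), Sig N M d * α (n+d)
      = ∑ d₁ ∈ (Finset.Icc (-(N:ℤ)) (N:ℤ)).erase 0,
        ∑ d₂ ∈ (Finset.Icc (-(N:ℤ)) (N:ℤ)).erase 0, M d₁ * M d₂ * α (n + d₁ + d₂) := by
  simp only [Sig_erase, Finset.sum_mul]
  rw [Finset.sum_comm]
  apply Finset.sum_congr rfl
  intro a ha
  rw [Finset.sum_comm]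
  apply Finset.sum_congr rfl
  intro b hb
  simp only [Finset.mem_erase, Finset.mem_Icc] at ha hb
  rw [Finset.sum_eq_single (a + b)]
  · simp [add_assoc]
  · intro c _ hc
    simp [Ne.symm hc]
  · intro h
    exact absurd (Finset.mem_Icc.2 ⟨by omega, by omega⟩) h

lemma Sig_zero_s13 (N : ℕ) (M : ℤ → ℝ) (hM1 : ∀ d : ℤ, M d + M (-d) = 0) :
    Sig N M 0 = -∑ d ∈ (Finset.Icc (-(N:ℤ)) N).erase 0, M d ^ 2 := by
  rw [Sig_erase, ← Finset.sum_neg_distrib]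
  apply Finset.sum_congr rfl
  intro a ha
  simp only [Finset.mem_erase, Finset.mem_Icc] at ha
  rw [Finset.sum_eq_single (-a)]
  · have := hM1 a
    have h : M (-a) = - M a := by linarith
    simp [h, pow_two]
  · intro c _ hc
    rw [if_neg]
    omega
  · intro h
    exact absurd (by simp only [Finset.mem_erase, Finset.mem_Icc]; omega) h

lemma Kcoef_zero (N : ℕ) (M : ℤ → ℝ) (d : ℤ) (hd : |d| ≤ 2 * (N:ℤ)) :
    -2 * Kcoef N M d 0 = if d = 0 then -6 * ∑ j ∈ Finset.Icc (1:ℤ) N, M j ^ 2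
      else Sig N M d + if |d| ≤ (N:ℤ) then 2 * M d ^ 2 else 0 := by
  unfold Kcoef
  by_cases h0 : d = 0
  · simp [h0]; ring
  · have h1 : 1 ≤ |d| := Int.one_le_abs h0
    by_cases h2 : |d| ≤ (N:ℤ)
    · simp only [h0, h1, h2]; simp; ring
    · have h3 : (N:ℤ) + 1 ≤ |d| := by omega
      simp only [h0, h1, h2, h3, hd]; simp

/-- **Drift identity for the generator:** for every `α : ℤ → ℝ` and site `n`,
`∑_{1≤|d₁|,|d₂|≤N} M(d₁)M(d₂) α_{n+d₁+d₂} + ∑_{1≤|d|≤N} M(d)² (α_{n+d} − 2α_n + α_{n−d})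
 = −2 ∑_{|d|≤2N} K_M(d,0) α_{n+d}`. -/
theorem drift_identity (N : ℕ) (hN : 1 ≤ N) (M : ℤ → ℝ)
    (hM1 : ∀ d : ℤ, M d + M (-d) = 0)
    (hM2 : ∀ d : ℤ, (2*|d| ≤ (N:ℤ) ∨ (N:ℤ) < |d|) → M d = 0)
    (α : ℤ → ℝ) (n : ℤ) :
    (∑ d₁ ∈ (Finset.Icc (-(N:ℤ)) (N:ℤ)).erase 0,
        ∑ d₂ ∈ (Finset.Icc (-(N:ℤ)) (N:ℤ)).erase 0,
          M d₁ * M d₂ * α (n + d₁ + d₂))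
      + ∑ d ∈ (Finset.Icc (-(N:ℤ)) (N:ℤ)).erase 0,
          M d ^ 2 * (α (n+d) - 2 * α n + α (n-d))
      = -2 * ∑ d ∈ Finset.Icc (-(2*(N:ℤ))) (2*(N:ℤ)), Kcoef N M d 0 * α (n+d) := by
  have hS := sum_Icc_symm N (fun d => M d ^ 2)
  have hneg : ∀ d, M (-d) = - M d := fun d => by linarith [hM1 d]
  simp only [hneg, neg_sq] at hS
  have hz := Sig_zero_s13 N M hM1
  have hsq : ∑ d ∈ (Finset.Icc (-(N:ℤ)) (N:ℤ)).erase 0, M d ^ 2 * (α (n+d) - 2 * α n + α (n-d))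
      = 2 * ∑ d ∈ (Finset.Icc (-(N:ℤ)) (N:ℤ)).erase 0, M d ^ 2 * α (n+d)
        - 2 * (∑ d ∈ (Finset.Icc (-(N:ℤ)) (N:ℤ)).erase 0, M d ^ 2) * α n := by
    have e1 := sum_Icc_symm N (fun d => M d ^ 2 * α (n+d))
    have e2 := sum_Icc_symm N (fun d => M d ^ 2 * α (n-d))
    simp only [hneg, neg_sq, sub_neg_eq_add, ← sub_eq_add_neg] at e1 e2
    have e3 : ∑ d ∈ (Finset.Icc (-(N:ℤ)) (N:ℤ)).erase 0,
        M d ^ 2 * (α (n+d) - 2 * α n + α (n-d))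
        = ∑ d ∈ (Finset.Icc (-(N:ℤ)) (N:ℤ)).erase 0, M d ^ 2 * α (n+d)
        - 2 * (∑ d ∈ (Finset.Icc (-(N:ℤ)) (N:ℤ)).erase 0, M d ^ 2) * α n
        + ∑ d ∈ (Finset.Icc (-(N:ℤ)) (N:ℤ)).erase 0, M d ^ 2 * α (n-d) := by
      rw [Finset.mul_sum, Finset.sum_mul, ← Finset.sum_sub_distrib, ← Finset.sum_add_distrib]
      exact Finset.sum_congr rfl (fun _ _ => by ring)
    rw [e3]
    linarith
  rw [← sum_Sig, hsq]
  have h0 : (0:ℤ) ∈ Finset.Icc (-(2*(N:ℤ))) (2*(N:ℤ)) := by simp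
  rw [← Finset.sum_erase_add _ (fun d => Sig N M d * α (n+d)) h0,
    ← Finset.sum_erase_add _ (fun d => Kcoef N M d 0 * α (n+d)) h0, mul_add,
    Finset.mul_sum ((Finset.Icc (-(2*(N:ℤ))) (2*(N:ℤ))).erase 0)]
  have hR : ∑ d ∈ (Finset.Icc (-(2*(N:ℤ))) (2*(N:ℤ))).erase 0, -2 * (Kcoef N M d 0 * α (n+d))
      = ∑ d ∈ (Finset.Icc (-(2*(N:ℤ))) (2*(N:ℤ))).erase 0, Sig N M d * α (n+d)
        + 2 * ∑ d ∈ (Finset.Icc (-(N:ℤ)) (N:ℤ)).erase 0, M d ^ 2 * α (n+d) := by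
    have hsub : (Finset.Icc (-(N:ℤ)) (N:ℤ)).erase 0
        ⊆ (Finset.Icc (-(2*(N:ℤ))) (2*(N:ℤ))).erase 0 := by
      intro d
      simp only [Finset.mem_erase, Finset.mem_Icc]
      omega
    rw [Finset.sum_subset hsub, Finset.mul_sum, ← Finset.sum_add_distrib]
    · apply Finset.sum_congr rfl
      intro d hd
      simp only [Finset.mem_erase, Finset.mem_Icc] at hd
      rw [← mul_assoc, Kcoef_zero N M d (abs_le.2 hd.2), if_neg hd.1]
      split_ifs with h
      · ring
      · rw [hM2 d (Or.inr (not_le.1 h))]; ring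
    · intro d hd hd'
      simp only [Finset.mem_erase, Finset.mem_Icc] at hd hd'
      rw [hM2 d (Or.inr _)]
      · ring
      · rw [lt_abs]; omega
  have hK0 := Kcoef_zero N M 0 (by simp)
  rw [if_pos rfl] at hK0
  rw [hR, hz, ← mul_assoc, hK0, hS, add_zero]
  ring
end
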